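/- arXiv:2110.15274 — 2 statements merged into one kernel-verified Lean document; each statement's English description precedes it below -/
import Mathlib

section
/- Let n, k be natural numbers with k ≤ n and set m := n − k. Given integer matrices X₂ ∈ ℤ^{m×k}, Z₁ ∈ ℤ^{m×m}, Z₂ ∈ ℤ^{m×k}, form the canonical-form rows r_1,…,r_m ∈ ℤ^{2n} whose x-part is the corresponding row of the block matrix [I_m X₂] and whose z-part is the corresponding row of [Z₁ Z₂]. Define L⁺ ∈ ℤ^{m×m} by L⁺_{ij} = max(⟨r_i, r_j⟩, 0), and let r'_1,…,r'_m be the modified rows whose x-part is unchanged and whose z-part is the corresponding row of [Z₁ + L⁺ Z₂]. Then ⟨r'_i, r'_j⟩ = 0 over ℤ for all i, j; moreover, if all entries of X₂, Z₁, Z₂ are non-negative, then every entry of every modified row r'_i is non-negative. -/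
open Matrix BigOperators

/-- Symplectic product of two vectors in `ℤ^{2n}`, given by their x- and z-parts:
`⟨u, v⟩ = ∑ t, (v_z t * u_x t - v_x t * u_z t)`. -/
def sympProd {ι : Type*} [Fintype ι] (ux uz vx vz : ι → ℤ) : ℤ :=
  ∑ t, (vz t * ux t - vx t * uz t)

theorem sympProd_swap {ι : Type*} [Fintype ι] (ux uz vx vz : ι → ℤ) :
    sympProd vx vz ux uz = -sympProd ux uz vx vz := by
  simp only [sympProd, ← Finset.sum_neg_distrib]
  exact Finset.sum_congr rfl fun t _ => by ring

theorem sympProd_add_z {ι : Type*} [Fintype ι] (ux uz vx vz a b : ι → ℤ) :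
    sympProd ux (uz + a) vx (vz + b) = sympProd ux uz vx vz + sympProd ux a vx b := by
  simp only [sympProd, ← Finset.sum_add_distrib, Pi.add_apply]
  exact Finset.sum_congr rfl fun t _ => by ring

/-- The `L⁺` variant of the LDI form construction: starting from canonical-form rows
`[I_m X₂ | Z₁ Z₂]`, adding `L⁺_{ij} = max(⟨r_i, r_j⟩, 0)` to `Z₁` makes all pairwise
symplectic products vanish over `ℤ`; moreover if all entries of `X₂, Z₁, Z₂` are
non-negative then every entry of every modified row is non-negative. -/
theorem ldi_plus_form (n k : ℕ) (hk : k ≤ n)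
    (X₂ : Matrix (Fin (n - k)) (Fin k) ℤ)
    (Z₁ : Matrix (Fin (n - k)) (Fin (n - k)) ℤ)
    (Z₂ : Matrix (Fin (n - k)) (Fin k) ℤ)
    (x z z' : Fin (n - k) → (Fin (n - k) ⊕ Fin k) → ℤ)
    (L : Matrix (Fin (n - k)) (Fin (n - k)) ℤ)
    (hx : ∀ i, x i = Sum.elim (fun j => if i = j then (1 : ℤ) else 0) (X₂ i))
    (hz : ∀ i, z i = Sum.elim (Z₁ i) (Z₂ i))
    (hL : ∀ i j, L i j = max (sympProd (x i) (z i) (x j) (z j)) 0)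
    (hz' : ∀ i, z' i = Sum.elim (fun j => Z₁ i j + L i j) (Z₂ i)) :
    (∀ i j, sympProd (x i) (z' i) (x j) (z' j) = 0) ∧
    ((∀ i j, 0 ≤ X₂ i j) → (∀ i j, 0 ≤ Z₁ i j) → (∀ i j, 0 ≤ Z₂ i j) →
      ∀ i t, 0 ≤ Sum.elim (x i) (z' i) t) := by
  have hadd : ∀ i, z' i = z i + Sum.elim (L i) 0 := by
    intro i
    funext t
    rcases t with t | t <;> simp [hz, hz']
  refine ⟨fun i j => ?_, fun hX hZ₁ hZ₂ i t => ?_⟩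
  · have hcorr : sympProd (x i) (Sum.elim (L i) 0) (x j) (Sum.elim (L j) 0) = L j i - L i j := by
      simp [sympProd, hx, Finset.sum_sub_distrib]
    rw [hadd, hadd, sympProd_add_z, hcorr, hL, hL, sympProd_swap (x i) (z i) (x j) (z j)]
    omega
  · have hLnonneg : ∀ i j, 0 ≤ L i j := fun i j => hL i j ▸ le_max_right _ _
    rcases t with (t | t) | (t | t)
    · simp only [Sum.elim_inl, hx]
      split_ifs <;> norm_num
    · simpa [hx] using hX i t
    · simpa [hz'] using add_nonneg (hZ₁ i t) (hLnonneg i t)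
    · simpa [hz'] using hZ₂ i t
end

section
/- Let q ≥ 2, d ≥ 2 be natural numbers and B ≥ 0 a real number. Let X₁, X₂, Z₁, Z₂ be (d−1)×(d−1) integer matrices with |(X₁)_{ij}| ≤ q−1 and |(X₂)_{ij}| ≤ q−1 for all i, j, with |(Z₁)_{ij}| ≤ B and |(Z₂)_{ij}| ≤ B for all i, j, and with det X₁ ≠ 0. Let M be the 2(d−1)×2(d−1) block matrix [[X₁, Z₁],[X₂, Z₂]] and assume det M ≠ 0 over ℤ. Then for every prime p with (p : ℝ) > (B(q−1)(d−1)(1 + (d−1)²(q−1)^{d−1}(d−2)^{(d−2)/2}))^{d−1} (real exponent (d−2)/2), the reduction of M modulo p has nonzero determinant over ZMod p, i.e. M mod p is invertible and has trivial kernel. -/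
open Matrix Real

lemma two_pow_mul_factorial_le_succ_pow (n : ℕ) : 2 ^ n * n.factorial ≤ (n + 1) ^ n := by
  induction n with
  | zero => simp
  | succ m ih =>
    have hbern : 2 * (m + 1) ^ (m + 1) ≤ (m + 2) ^ (m + 1) := by
      have hpos : (0 : ℝ) < (m : ℝ) + 1 := by positivity
      have hinv : (-2 : ℝ) ≤ 1 / ((m : ℝ) + 1) := by
        have : 0 < 1 / ((m : ℝ) + 1) := by positivity
        linarith
      have h := one_add_mul_le_pow hinv (m + 1)
      have hone : 1 + ((m + 1 : ℕ) : ℝ) * (1 / ((m : ℝ) + 1)) = 2 := by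
        push_cast
        field_simp
        norm_num
      have hbase : (1 + 1 / ((m : ℝ) + 1)) * ((m : ℝ) + 1) = m + 2 := by
        field_simp
        ring
      rw [hone] at h
      have h' := mul_le_mul_of_nonneg_right h (pow_nonneg hpos.le (m + 1))
      rw [← mul_pow, hbase] at h'
      exact_mod_cast h'
    calc 2 ^ (m + 1) * (m + 1).factorial
        = 2 * (m + 1) * (2 ^ m * m.factorial) := by rw [Nat.factorial_succ]; ring
      _ ≤ 2 * (m + 1) * (m + 1) ^ m := by gcongr
      _ = 2 * (m + 1) ^ (m + 1) := by ring
      _ ≤ (m + 1 + 1) ^ (m + 1) := hbern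

lemma factorial_two_mul_le_mul_succ_pow (n : ℕ) : (2 * n).factorial ≤ (n * (n + 1)) ^ n :=
  calc (2 * n).factorial ≤ (2 * n) ^ n * n.factorial := Nat.factorial_two_mul_le n
    _ = n ^ n * (2 ^ n * n.factorial) := by ring
    _ ≤ n ^ n * (n + 1) ^ n := by gcongr; exact two_pow_mul_factorial_le_succ_pow n
    _ = (n * (n + 1)) ^ n := by rw [mul_pow]

/-- The Leibniz bound for a determinant whose entries are bounded column by column. -/
lemma abs_det_le_of_column_bound {n : Type*} [Fintype n] [DecidableEq n]
    (A : Matrix n n ℝ) (b : n → ℝ) (h : ∀ i j, |A i j| ≤ b j) :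
    |A.det| ≤ (Fintype.card n).factorial * ∏ j, b j :=
  calc |A.det| ≤ ∑ σ : Equiv.Perm n, |Equiv.Perm.sign σ • ∏ i, A (σ i) i| := by
        rw [det_apply]
        exact Finset.abs_sum_le_sum_abs _ _
    _ = ∑ σ : Equiv.Perm n, ∏ i, |A (σ i) i| := by
        refine Finset.sum_congr rfl fun σ _ => ?_
        rcases Int.units_eq_one_or (Equiv.Perm.sign σ) with hs | hs <;>
          simp [hs, Finset.abs_prod]
    _ ≤ ∑ _σ : Equiv.Perm n, ∏ j, b j :=
        Finset.sum_le_sum fun σ _ =>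
          Finset.prod_le_prod (fun _ _ => abs_nonneg _) fun i _ => h (σ i) i
    _ = (Fintype.card n).factorial * ∏ j, b j := by simp [Fintype.card_perm]

lemma abs_det_fromBlocks_le {m : ℕ} {a b : ℝ} (ha : 0 ≤ a) (hb : 0 ≤ b)
    (X₁ X₂ Z₁ Z₂ : Matrix (Fin m) (Fin m) ℝ)
    (hX₁ : ∀ i j, |X₁ i j| ≤ a) (hX₂ : ∀ i j, |X₂ i j| ≤ a)
    (hZ₁ : ∀ i j, |Z₁ i j| ≤ b) (hZ₂ : ∀ i j, |Z₂ i j| ≤ b) :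
    |(fromBlocks X₁ Z₁ X₂ Z₂).det| ≤ (b * a * m * (1 + m)) ^ m := by
  have h := abs_det_le_of_column_bound (fromBlocks X₁ Z₁ X₂ Z₂)
    (Sum.elim (fun _ => a) (fun _ => b))
    (by rintro (i | i) (j | j) <;> simp [hX₁, hX₂, hZ₁, hZ₂])
  have hfac : ((2 * m).factorial : ℝ) ≤ ((m : ℝ) * (m + 1)) ^ m := by
    exact_mod_cast factorial_two_mul_le_mul_succ_pow m
  calc _ ≤ ((2 * m).factorial : ℝ) * (a ^ m * b ^ m) := by
        simpa [Fintype.prod_sum_type, ← two_mul] using h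
    _ ≤ ((m : ℝ) * (m + 1)) ^ m * (a ^ m * b ^ m) := by gcongr
    _ = (b * a * m * (1 + m)) ^ m := by
        rw [← mul_pow, ← mul_pow]
        ring

lemma natCast_le_sq_mul_pow_mul_rpow {m : ℕ} (hm : 1 ≤ m) {a : ℝ} (ha : 1 ≤ a) :
    (m : ℝ) ≤ (m : ℝ) ^ 2 * a ^ m * ((m : ℝ) - 1) ^ (((m : ℝ) - 1) / 2) := by
  have hm' : (1 : ℝ) ≤ m := by exact_mod_cast hm
  have hpow : (1 : ℝ) ≤ a ^ m := one_le_pow₀ ha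
  have hrpow : (1 : ℝ) ≤ ((m : ℝ) - 1) ^ (((m : ℝ) - 1) / 2) := by
    obtain rfl | hlt := hm.eq_or_lt
    · simp
    · have h2 : (2 : ℝ) ≤ m := by exact_mod_cast hlt
      exact one_le_rpow (by linarith) (by linarith)
  calc (m : ℝ) ≤ (m : ℝ) ^ 2 := by nlinarith
    _ = (m : ℝ) ^ 2 * 1 * 1 := by ring
    _ ≤ _ := by gcongr

/-- Linear-algebraic core of Theorem 3 of the paper: a `2(d-1) × 2(d-1)` block
minor `M = [[X₁, Z₁], [X₂, Z₂]]` (entries of `X₁, X₂` bounded by `q - 1`, entries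
of `Z₁, Z₂` bounded by `B`, `det X₁ ≠ 0`) with nonzero integer determinant stays
nonsingular modulo any prime `p` exceeding the cutoff
`p* = (B (q-1)(d-1)(1 + (d-1)² (q-1)^{d-1} (d-2)^{(d-2)/2}))^{d-1}`. -/
theorem no_artifact_error_above_cutoff (q d : ℕ) (hq : 2 ≤ q) (hd : 2 ≤ d)
    (B : ℝ) (hB : 0 ≤ B)
    (X₁ X₂ Z₁ Z₂ : Matrix (Fin (d - 1)) (Fin (d - 1)) ℤ)
    (hX₁ : ∀ i j, |X₁ i j| ≤ (q : ℤ) - 1)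
    (hX₂ : ∀ i j, |X₂ i j| ≤ (q : ℤ) - 1)
    (hZ₁ : ∀ i j, |((Z₁ i j : ℤ) : ℝ)| ≤ B)
    (hZ₂ : ∀ i j, |((Z₂ i j : ℤ) : ℝ)| ≤ B)
    (hdetX₁ : X₁.det ≠ 0)
    (hdetM : (Matrix.fromBlocks X₁ Z₁ X₂ Z₂).det ≠ 0)
    (p : ℕ) (hp : p.Prime)
    (hpgt : (p : ℝ) >
      (B * ((q : ℝ) - 1) * ((d : ℝ) - 1) *
        (1 + ((d : ℝ) - 1) ^ 2 * ((q : ℝ) - 1) ^ (d - 1) *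
          ((d : ℝ) - 2) ^ (((d : ℝ) - 2) / 2))) ^ (d - 1)) :
    ((Matrix.fromBlocks X₁ Z₁ X₂ Z₂).map (Int.cast : ℤ → ZMod p)).det ≠ 0 ∧
    IsUnit ((Matrix.fromBlocks X₁ Z₁ X₂ Z₂).map (Int.cast : ℤ → ZMod p)) ∧
    ∀ v : (Fin (d - 1) ⊕ Fin (d - 1)) → ZMod p,
      ((Matrix.fromBlocks X₁ Z₁ X₂ Z₂).map (Int.cast : ℤ → ZMod p)).mulVec v = 0 →
        v = 0 := by
  obtain ⟨m, rfl⟩ : ∃ m, d = m + 1 := ⟨d - 1, by omega⟩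
  simp only [Nat.add_sub_cancel] at *
  have : Fact p.Prime := ⟨hp⟩
  set M := fromBlocks X₁ Z₁ X₂ Z₂ with hM
  have hq' : (1 : ℝ) ≤ (q : ℝ) - 1 := by
    have : (2 : ℝ) ≤ q := by exact_mod_cast hq
    linarith
  have hbound : |((M.det : ℤ) : ℝ)| ≤ (B * ((q : ℝ) - 1) * m * (1 + m)) ^ m := by
    have h := abs_det_fromBlocks_le (zero_le_one.trans hq') hB
      (X₁.map (Int.cast : ℤ → ℝ)) (X₂.map Int.cast) (Z₁.map Int.cast) (Z₂.map Int.cast)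
      (fun i j => by simpa using (by exact_mod_cast hX₁ i j : |((X₁ i j : ℤ) : ℝ)| ≤ (q : ℝ) - 1))
      (fun i j => by simpa using (by exact_mod_cast hX₂ i j : |((X₂ i j : ℤ) : ℝ)| ≤ (q : ℝ) - 1))
      (by simpa using hZ₁) (by simpa using hZ₂)
    rwa [← fromBlocks_map, ← hM, ← Int.cast_det] at h
  have hlt : |((M.det : ℤ) : ℝ)| < p := by
    refine (hbound.trans ?_).trans_lt hpgt
    have hd1 : ((m + 1 : ℕ) : ℝ) - 1 = m := by push_cast; ring
    have hd2 : ((m + 1 : ℕ) : ℝ) - 2 = (m : ℝ) - 1 := by push_cast; ring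
    rw [hd1, hd2]
    have := natCast_le_sq_mul_pow_mul_rpow (m := m) (by omega) hq'
    gcongr
  have hdet : (M.map (Int.cast : ℤ → ZMod p)).det ≠ 0 := by
    rw [← Int.cast_det, Ne, ZMod.intCast_zmod_eq_zero_iff_dvd]
    intro hdvd
    exact hdetM (Int.eq_zero_of_abs_lt_dvd hdvd (by exact_mod_cast hlt))
  exact ⟨hdet, (isUnit_iff_isUnit_det _).2 (isUnit_iff_ne_zero.2 hdet),
    fun v hv => eq_zero_of_mulVec_eq_zero hdet hv⟩
end
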